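/- Fix game G_i and suppose the Eater plays π^{E*}. If π^M is any admissible Mover strategy whose resulting path contains at least one move that increases the distance to both goals (δd₁(t) = δd₂(t) = +1 for some t), then J_i(π^M, π^{E*}) ≥ J_i(π^{M*}_i, π^{E*}); i.e., the Mover has no incentive to deviate from a shortest path by moving away from both goals. -/

import Mathlib

noncomputable section

open Classical

/-- Manhattan distance on the grid ℤ². -/
def mdist (p q : ℤ × ℤ) : ℤ := |p.1 - q.1| + |p.2 - q.2|

/-- The four admissible unit moves of the Mover. -/
def IsUnitMove (e : ℤ × ℤ) : Prop :=
  e = (1, 0) ∨ e = (-1, 0) ∨ e = (0, 1) ∨ e = (0, -1)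

/-- The Eater action that eats one banana from goal `j`. -/
def eatOne (j : Fin 2) : Fin 2 → ℝ := fun k => if k = j then 1 else 0

/-- The Eater action that eats half a banana from each goal. -/
def eatHalf : Fin 2 → ℝ := fun _ => 1 / 2

/-- The three admissible Eater actions. -/
def IsEaterAction (a : Fin 2 → ℝ) : Prop :=
  a = eatOne 0 ∨ a = eatOne 1 ∨ a = eatHalf

/-- A Mover strategy: maps (position, consumption vector) to a move. -/
abbrev MoverStrategy : Type := ℤ × ℤ → (Fin 2 → ℝ) → ℤ × ℤ

/-- An Eater strategy: maps (new Mover position, last Mover move, current consumption)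
to an Eater action; it is the same in both games. -/
abbrev EaterStrategy : Type := ℤ × ℤ → ℤ × ℤ → (Fin 2 → ℝ) → Fin 2 → ℝ

def ValidMover (piM : MoverStrategy) : Prop := ∀ p b, IsUnitMove (piM p b)

def ValidEater (piE : EaterStrategy) : Prop := ∀ p a b, IsEaterAction (piE p a b)

/-- State trajectory (position, consumption vector) of the game under a strategy pair:
`p(t+1) = p(t) + a^M(t)`, `b(t+1) = b(t) + a^E(t)`. -/
def traj (piM : MoverStrategy) (piE : EaterStrategy) (p0 : ℤ × ℤ) (b0 : Fin 2 → ℝ) :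
    ℕ → (ℤ × ℤ) × (Fin 2 → ℝ)
  | 0 => (p0, b0)
  | t + 1 =>
    let s := traj piM piE p0 b0 t
    let m := piM s.1 s.2
    (s.1 + m, fun j => s.2 j + piE (s.1 + m) m s.2 j)

/-- Termination time of game `G_i`: the first time the Mover's position equals `goal`. -/
def hitTime (piM : MoverStrategy) (piE : EaterStrategy) (p0 : ℤ × ℤ) (b0 : Fin 2 → ℝ)
    (goal : ℤ × ℤ) : ℕ :=
  sInf {t | (traj piM piE p0 b0 t).1 = goal}

/-- The outcome `J_i` of game `G_i`: consumption at the true goal `g i` at termination. -/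
def outcome (g : Fin 2 → ℤ × ℤ) (i : Fin 2) (piM : MoverStrategy) (piE : EaterStrategy)
    (p0 : ℤ × ℤ) (b0 : Fin 2 → ℝ) : ℝ :=
  (traj piM piE p0 b0 (hitTime piM piE p0 b0 (g i))).2 i

/-- Admissibility: the Mover reaches the goal in finite time. -/
def Reaches (piM : MoverStrategy) (piE : EaterStrategy) (p0 : ℤ × ℤ) (b0 : Fin 2 → ℝ)
    (goal : ℤ × ℤ) : Prop :=
  ∃ t, (traj piM piE p0 b0 t).1 = goal

/-- A step from `p` to `p'` is ambiguous: `δd₁ = δd₂`. -/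
def IsAmbStep (g : Fin 2 → ℤ × ℤ) (p p' : ℤ × ℤ) : Prop :=
  mdist p' (g 0) - mdist p (g 0) = mdist p' (g 1) - mdist p (g 1)

/-- A step from `p` to `p'` is explicit: `δd₁ = −δd₂`. -/
def IsExpStep (g : Fin 2 → ℤ × ℤ) (p p' : ℤ × ℤ) : Prop :=
  mdist p' (g 0) - mdist p (g 0) = -(mdist p' (g 1) - mdist p (g 1))

/-- A path of `T` unit moves from `p` to `goal`. -/
def IsPath (p goal : ℤ × ℤ) (T : ℕ) (q : ℕ → ℤ × ℤ) : Prop :=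
  q 0 = p ∧ q T = goal ∧ ∀ t < T, IsUnitMove (q (t + 1) - q t)

/-- Number of ambiguous moves along a path. -/
def ambCount (g : Fin 2 → ℤ × ℤ) (T : ℕ) (q : ℕ → ℤ × ℤ) : ℕ :=
  ((Finset.range T).filter fun t => IsAmbStep g (q t) (q (t + 1))).card

/-- Number of explicit moves along a path. -/
def expCount (g : Fin 2 → ℤ × ℤ) (T : ℕ) (q : ℕ → ℤ × ℤ) : ℕ :=
  ((Finset.range T).filter fun t => IsExpStep g (q t) (q (t + 1))).card

/-- `n^a(p)`: minimum number of ambiguous moves over paths from `p` to a goal. -/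
def naN (g : Fin 2 → ℤ × ℤ) (p : ℤ × ℤ) : ℕ :=
  sInf {n : ℕ | ∃ i : Fin 2, ∃ T q, IsPath p (g i) T q ∧ ambCount g T q = n}

/-- `n^r_i(p)`: minimum number of explicit moves needed to reach `g i` from `p`. -/
def nrN (g : Fin 2 → ℤ × ℤ) (i : Fin 2) (p : ℤ × ℤ) : ℕ :=
  sInf {n : ℕ | ∃ T q, IsPath p (g i) T q ∧ expCount g T q = n}

/-- The equilibrium Eater strategy `π^{E*}`: after an ambiguous Mover move the
conservative action (based on the sign of `δ̃c₁`), after an explicit move the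
exploiting action (eat from the approached goal). -/
def piEstar (g : Fin 2 → ℤ × ℤ) : EaterStrategy := fun p' a b =>
  let p := p' - a
  let d1 := mdist p' (g 0) - mdist p (g 0)
  let d2 := mdist p' (g 1) - mdist p (g 1)
  if d1 = d2 then
    if (b 0 + (mdist p' (g 0) : ℝ)) - (b 1 + (mdist p' (g 1) : ℝ)) < 0 then eatOne 0
    else if 0 < (b 0 + (mdist p' (g 0) : ℝ)) - (b 1 + (mdist p' (g 1) : ℝ)) then eatOne 1
    else eatHalf
  else if d1 < d2 then eatOne 0
  else eatOne 1

/-- `π^{M*}_i`: the Mover strategy that (against any Eater strategy) follows a shortest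
path from `p0` to `g i`, performing all `n^a(p0)` ambiguous moves first and then the
explicit moves. -/
def IsMoverStar (g : Fin 2 → ℤ × ℤ) (i : Fin 2) (p0 : ℤ × ℤ) (b0 : Fin 2 → ℝ)
    (piM : MoverStrategy) : Prop :=
  ValidMover piM ∧
  ∀ piE : EaterStrategy, ValidEater piE →
    (traj piM piE p0 b0 (mdist p0 (g i)).toNat).1 = g i ∧
    ∀ t < (mdist p0 (g i)).toNat,
      (IsAmbStep g (traj piM piE p0 b0 t).1 (traj piM piE p0 b0 (t + 1)).1 ↔ t < naN g p0)

/-- `c_i(p, b) = b_i + d(p, g_i)`. -/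
def cval (g : Fin 2 → ℤ × ℤ) (i : Fin 2) (p : ℤ × ℤ) (b : Fin 2 → ℝ) : ℝ :=
  b i + (mdist p (g i) : ℝ)

/-- `δc_i = c_i − c_{3−i}`. -/
def dcval (g : Fin 2 → ℤ × ℤ) (i : Fin 2) (p : ℤ × ℤ) (b : Fin 2 → ℝ) : ℝ :=
  cval g i p b - cval g (1 - i) p b

end

open Classical in
/-- value of the remaining ambiguous moves -/
noncomputable def Vf : ℕ → ℝ → ℝ
  | 0, _ => 0
  | n + 1, x => if x < 0 then Vf n (x + 1) else if 0 < x then Vf n (x - 1) - 1 else Vf n 0 - 1 / 2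

theorem Vf_mono (n : ℕ) : ∀ x : ℝ, Vf n (x + 1) ≤ Vf n x ∧ Vf n x ≤ Vf n (x + 1) + 1 := by
  induction n with
  | zero => intro x; simp [Vf]
  | succ n ih =>
    intro x
    simp only [Vf]
    have h1 := ih x
    have h2 := ih (x + 1)
    have h3 := ih (x - 1)
    rw [sub_add_cancel] at h3
    have h0 := ih 0
    rw [zero_add] at h0
    split_ifs
    all_goals try (exfalso; linarith)
    all_goals try rw [add_sub_cancel_right]
    all_goals try (constructor <;> linarith)
    · have : x = 0 := by linarith
      subst this
      norm_num
      linarith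
    · have : x = -1 := by linarith
      subst this
      norm_num
      linarith

theorem Vf_succ (n : ℕ) : ∀ x : ℝ, Vf n x - 1 ≤ Vf (n + 1) x := by
  induction n with
  | zero => intro x; simp only [Vf]; split_ifs <;> linarith
  | succ n ih =>
    intro x
    rw [Vf, Vf]
    have h1 := ih (x + 1)
    have h2 := ih (x - 1)
    have h3 := ih 0
    split_ifs <;> linarith

theorem mdist_step (p m q : ℤ × ℤ) (hm : IsUnitMove m) :
    mdist (p + m) q = mdist p q + 1 ∨ mdist (p + m) q = mdist p q - 1 := by
  obtain ⟨a, b⟩ := p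
  obtain ⟨c, d⟩ := q
  unfold mdist
  rcases hm with rfl | rfl | rfl | rfl <;> simp <;> grind

theorem mdist_nonneg' (p q : ℤ × ℤ) : 0 ≤ mdist p q := by
  unfold mdist; positivity

theorem mdist_tri (p q r : ℤ × ℤ) : mdist q r ≤ mdist p q + mdist p r := by
  unfold mdist; grind

theorem mdist_self' (p : ℤ × ℤ) : mdist p p = 0 := by simp [mdist]

theorem mdist_comm' (p q : ℤ × ℤ) : mdist p q = mdist q p := by
  unfold mdist; grind

/-- number of remaining ambiguous moves -/
def nn (g : Fin 2 → ℤ × ℤ) (p : ℤ × ℤ) : ℕ :=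
  ((mdist p (g 0) + mdist p (g 1) - mdist (g 0) (g 1)) / 2).toNat

theorem nn_goal (g : Fin 2 → ℤ × ℤ) (i : Fin 2) : nn g (g i) = 0 := by
  unfold nn
  fin_cases i
  · simp [mdist_self']
  · simp [mdist_self', mdist_comm' (g 1) (g 0)]

theorem step_cases (g : Fin 2 → ℤ × ℤ) (i : Fin 2) (p m : ℤ × ℤ) (b b' : Fin 2 → ℝ)
    (hm : IsUnitMove m) (hb' : ∀ j, b' j = b j + piEstar g (p + m) m b j) :
    (IsAmbStep g p (p + m) ∧ mdist (p + m) (g i) = mdist p (g i) - 1 ∧ nn g p = nn g (p + m) + 1 ∧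
      (dcval g i p b < 0 ∧ cval g i (p + m) b' = cval g i p b ∧
          dcval g i (p + m) b' = dcval g i p b + 1 ∨
        dcval g i p b = 0 ∧ cval g i (p + m) b' = cval g i p b - 1 / 2 ∧
          dcval g i (p + m) b' = 0 ∨
        0 < dcval g i p b ∧ cval g i (p + m) b' = cval g i p b - 1 ∧
          dcval g i (p + m) b' = dcval g i p b - 1)) ∨
    (IsAmbStep g p (p + m) ∧ mdist (p + m) (g i) = mdist p (g i) + 1 ∧ nn g (p + m) = nn g p + 1 ∧
      (dcval g i p b < 0 ∧ cval g i (p + m) b' = cval g i p b + 2 ∧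
          dcval g i (p + m) b' = dcval g i p b + 1 ∨
        dcval g i p b = 0 ∧ cval g i (p + m) b' = cval g i p b + 3 / 2 ∧
          dcval g i (p + m) b' = 0 ∨
        0 < dcval g i p b ∧ cval g i (p + m) b' = cval g i p b + 1 ∧
          dcval g i (p + m) b' = dcval g i p b - 1)) ∨
    (¬ IsAmbStep g p (p + m) ∧ mdist (p + m) (g i) = mdist p (g i) - 1 ∧ nn g (p + m) = nn g p ∧
      cval g i (p + m) b' = cval g i p b ∧ dcval g i (p + m) b' = dcval g i p b - 1) ∨
    (¬ IsAmbStep g p (p + m) ∧ mdist (p + m) (g i) = mdist p (g i) + 1 ∧ nn g (p + m) = nn g p ∧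
      cval g i (p + m) b' = cval g i p b + 1 ∧ dcval g i (p + m) b' = dcval g i p b + 1) := by
  have h0 := mdist_step p m (g 0) hm
  have h1 := mdist_step p m (g 1) hm
  have t := mdist_tri p (g 0) (g 1)
  have t' := mdist_tri (p + m) (g 0) (g 1)
  have hb0 := hb' 0
  have hb1 := hb' 1
  simp only [piEstar, add_sub_cancel_right] at hb0 hb1
  unfold dcval cval IsAmbStep nn
  generalize hE0 : mdist (p + m) (g 0) = e0 at h0 h1 t t' hb0 hb1 ⊢
  generalize hE1 : mdist (p + m) (g 1) = e1 at h0 h1 t t' hb0 hb1 ⊢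
  generalize hD0 : mdist p (g 0) = d0 at h0 h1 t t' hb0 hb1 ⊢
  generalize hD1 : mdist p (g 1) = d1 at h0 h1 t t' hb0 hb1 ⊢
  generalize mdist (g 0) (g 1) = D at t t' ⊢
  generalize hx : b 0 = x at hb0 hb1 ⊢
  generalize hy : b 1 = y at hb0 hb1 ⊢
  generalize hx' : b' 0 = x' at hb0 hb1 ⊢
  generalize hy' : b' 1 = y' at hb0 hb1 ⊢
  clear hb'
  have key : ((e0 = d0 - 1 ∧ e1 = d1 - 1 ∨ e0 = d0 + 1 ∧ e1 = d1 + 1) ∧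
      ((x + d0) - (y + d1) < 0 ∧ x' = x + 1 ∧ y' = y ∨
       (x + d0) - (y + d1) = 0 ∧ x' = x + 1 / 2 ∧ y' = y + 1 / 2 ∨
       0 < (x + d0) - (y + d1) ∧ x' = x ∧ y' = y + 1)) ∨
      (e0 = d0 - 1 ∧ e1 = d1 + 1 ∧ x' = x + 1 ∧ y' = y) ∨
      (e0 = d0 + 1 ∧ e1 = d1 - 1 ∧ x' = x ∧ y' = y + 1) := by
    by_cases hd : e0 - d0 = e1 - d1
    · left
      refine ⟨by omega, ?_⟩
      have hr : (e0 : ℝ) - d0 = e1 - d1 := by exact_mod_cast hd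
      have hs : (x + d0) - (y + d1) = (x + e0) - (y + (e1 : ℝ)) := by linarith
      rw [if_pos hd] at hb0 hb1
      rw [hs]
      rcases lt_trichotomy ((x + e0) - (y + (e1 : ℝ))) 0 with h | h | h
      · left; rw [if_pos h] at hb0 hb1
        refine ⟨h, ?_, ?_⟩
        · simpa [eatOne] using hb0
        · simpa [eatOne] using hb1
      · right; left; rw [if_neg (by rw [h]; exact lt_irrefl _), if_neg (by rw [h]; exact lt_irrefl _)] at hb0 hb1
        exact ⟨h, hb0, hb1⟩
      · right; right; rw [if_neg (not_lt.2 h.le), if_pos h] at hb0 hb1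
        refine ⟨h, ?_, ?_⟩
        · simpa [eatOne] using hb0
        · simpa [eatOne] using hb1
    · right
      rw [if_neg hd] at hb0 hb1
      by_cases hl : e0 - d0 < e1 - d1
      · left
        rw [if_pos hl] at hb0 hb1
        refine ⟨by omega, by omega, ?_, ?_⟩
        · simpa [eatOne] using hb0
        · simpa [eatOne] using hb1
      · right
        rw [if_neg hl] at hb0 hb1
        refine ⟨by omega, by omega, ?_, ?_⟩
        · simpa [eatOne] using hb0
        · simpa [eatOne] using hb1
  clear hb0 hb1 h0 h1
  fin_cases i
  · simp only [Fin.zero_eta, Fin.isValue, sub_zero, hD0, hD1, hE0, hE1, hx, hy, hx', hy']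
    clear hD0 hD1 hE0 hE1 hx hy hx' hy'
    rcases key with ⟨⟨rfl, rfl⟩ | ⟨rfl, rfl⟩, k⟩ | ⟨rfl, rfl, rfl, rfl⟩ | ⟨rfl, rfl, rfl, rfl⟩
    · left
      refine ⟨by omega, by omega, by omega, ?_⟩
      push_cast
      rcases k with ⟨k, rfl, rfl⟩ | ⟨k, rfl, rfl⟩ | ⟨k, rfl, rfl⟩
      · left; refine ⟨?_, ?_, ?_⟩ <;> linarith
      · right; left; refine ⟨?_, ?_, ?_⟩ <;> linarith
      · right; right; refine ⟨?_, ?_, ?_⟩ <;> linarith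
    · right; left
      refine ⟨by omega, by omega, by omega, ?_⟩
      push_cast
      rcases k with ⟨k, rfl, rfl⟩ | ⟨k, rfl, rfl⟩ | ⟨k, rfl, rfl⟩
      · left; refine ⟨?_, ?_, ?_⟩ <;> linarith
      · right; left; refine ⟨?_, ?_, ?_⟩ <;> linarith
      · right; right; refine ⟨?_, ?_, ?_⟩ <;> linarith
    · right; right; left
      refine ⟨by omega, by omega, by congr 2; ring, ?_, ?_⟩ <;> push_cast <;> ring
    · right; right; right
      refine ⟨by omega, by omega, by congr 2; ring, ?_, ?_⟩ <;> push_cast <;> ring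
  · simp only [Fin.mk_one, Fin.isValue, sub_self, hD0, hD1, hE0, hE1, hx, hy, hx', hy']
    clear hD0 hD1 hE0 hE1 hx hy hx' hy'
    rcases key with ⟨⟨rfl, rfl⟩ | ⟨rfl, rfl⟩, k⟩ | ⟨rfl, rfl, rfl, rfl⟩ | ⟨rfl, rfl, rfl, rfl⟩
    · left
      refine ⟨by omega, by omega, by omega, ?_⟩
      push_cast
      rcases k with ⟨k, rfl, rfl⟩ | ⟨k, rfl, rfl⟩ | ⟨k, rfl, rfl⟩
      · right; right; refine ⟨?_, ?_, ?_⟩ <;> linarith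
      · right; left; refine ⟨?_, ?_, ?_⟩ <;> linarith
      · left; refine ⟨?_, ?_, ?_⟩ <;> linarith
    · right; left
      refine ⟨by omega, by omega, by omega, ?_⟩
      push_cast
      rcases k with ⟨k, rfl, rfl⟩ | ⟨k, rfl, rfl⟩ | ⟨k, rfl, rfl⟩
      · right; right; refine ⟨?_, ?_, ?_⟩ <;> linarith
      · right; left; refine ⟨?_, ?_, ?_⟩ <;> linarith
      · left; refine ⟨?_, ?_, ?_⟩ <;> linarith
    · right; right; right
      refine ⟨by omega, by omega, by congr 2; ring, ?_, ?_⟩ <;> push_cast <;> ring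
    · right; right; left
      refine ⟨by omega, by omega, by congr 2; ring, ?_, ?_⟩ <;> push_cast <;> ring

theorem phi_mono (g : Fin 2 → ℤ × ℤ) (i : Fin 2) (p m : ℤ × ℤ) (b b' : Fin 2 → ℝ)
    (hm : IsUnitMove m) (hb' : ∀ j, b' j = b j + piEstar g (p + m) m b j) :
    cval g i p b + Vf (nn g p) (dcval g i p b) ≤
      cval g i (p + m) b' + Vf (nn g (p + m)) (dcval g i (p + m) b') := by
  have h := step_cases g i p m b b' hm hb'
  generalize dcval g i (p + m) b' = x' at *
  generalize dcval g i p b = x at *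
  generalize cval g i (p + m) b' = c' at *
  generalize cval g i p b = c at *
  generalize nn g (p + m) = n' at *
  generalize nn g p = n at *
  have m1 := Vf_mono n x
  have m2 := Vf_mono n (x - 1)
  have m3 := Vf_mono (n + 1) x
  have m4 := Vf_mono (n + 1) (x - 1)
  have s := Vf_succ n x
  rw [sub_add_cancel] at m2 m4
  rcases h with ⟨-, -, rfl, h⟩ | ⟨-, -, rfl, h⟩ | ⟨-, -, rfl, rfl, rfl⟩ | ⟨-, -, rfl, rfl, rfl⟩
  · rcases h with ⟨hx, rfl, rfl⟩ | ⟨hx, rfl, rfl⟩ | ⟨hx, rfl, rfl⟩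
    · simp [Vf, hx]
    · subst hx; simp [Vf]; linarith
    · simp [Vf, hx, hx.le, not_lt.2 hx.le]; linarith
  · rcases h with ⟨hx, rfl, rfl⟩ | ⟨hx, rfl, rfl⟩ | ⟨hx, rfl, rfl⟩
    · linarith
    · subst hx; linarith
    · linarith
  · linarith
  · linarith

theorem phi_star (g : Fin 2 → ℤ × ℤ) (i : Fin 2) (p m : ℤ × ℤ) (b b' : Fin 2 → ℝ)
    (hm : IsUnitMove m) (hb' : ∀ j, b' j = b j + piEstar g (p + m) m b j)
    (hd : mdist (p + m) (g i) = mdist p (g i) - 1)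
    (hn : ¬ IsAmbStep g p (p + m) → nn g p = 0) :
    cval g i p b + Vf (nn g p) (dcval g i p b) =
      cval g i (p + m) b' + Vf (nn g (p + m)) (dcval g i (p + m) b') := by
  have h := step_cases g i p m b b' hm hb'
  generalize dcval g i (p + m) b' = x' at *
  generalize dcval g i p b = x at *
  generalize cval g i (p + m) b' = c' at *
  generalize cval g i p b = c at *
  generalize nn g (p + m) = n' at *
  generalize nn g p = n at *
  rcases h with ⟨-, -, rfl, h⟩ | ⟨-, h, -⟩ | ⟨ha, -, rfl, rfl, rfl⟩ | ⟨-, h, -⟩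
  · rcases h with ⟨hx, rfl, rfl⟩ | ⟨hx, rfl, rfl⟩ | ⟨hx, rfl, rfl⟩
    · simp [Vf, hx]
    · subst hx; simp [Vf]; ring
    · simp [Vf, hx, not_lt.2 hx.le]; ring
  · omega
  · rw [hn ha]; simp [Vf]
  · omega

theorem validEater_star (g : Fin 2 → ℤ × ℤ) : ValidEater (piEstar g) := by
  intro p a b
  unfold piEstar IsEaterAction
  dsimp only
  split_ifs <;> simp

/-- the potential along a trajectory -/
noncomputable def Phi (g : Fin 2 → ℤ × ℤ) (i : Fin 2) (s : (ℤ × ℤ) × (Fin 2 → ℝ)) : ℝ :=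
  cval g i s.1 s.2 + Vf (nn g s.1) (dcval g i s.1 s.2)

theorem Phi_goal (g : Fin 2 → ℤ × ℤ) (i : Fin 2) (s : (ℤ × ℤ) × (Fin 2 → ℝ)) (h : s.1 = g i) :
    Phi g i s = s.2 i := by
  unfold Phi
  rw [h, nn_goal]
  simp [Vf, cval, mdist_self']

theorem Phi_traj_mono (g : Fin 2 → ℤ × ℤ) (i : Fin 2) (piM : MoverStrategy) (hM : ValidMover piM)
    (p0 : ℤ × ℤ) (b0 : Fin 2 → ℝ) (t : ℕ) :
    Phi g i (p0, b0) ≤ Phi g i (traj piM (piEstar g) p0 b0 t) := by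
  induction t with
  | zero => exact le_rfl
  | succ t ih => exact ih.trans (phi_mono g i _ _ _ _ (hM _ _) (fun j => rfl))

theorem star_value (g : Fin 2 → ℤ × ℤ) (i : Fin 2) (p0 : ℤ × ℤ) (b0 : Fin 2 → ℝ)
    (piM : MoverStrategy) (hstar : IsMoverStar g i p0 b0 piM) :
    outcome g i piM (piEstar g) p0 b0 = Phi g i (p0, b0) := by
  obtain ⟨hM, h⟩ := hstar
  obtain ⟨hend, hamb⟩ := h (piEstar g) (validEater_star g)
  set D := (mdist p0 (g i)).toNat with hD
  have hD' : (D : ℤ) = mdist p0 (g i) := Int.toNat_of_nonneg (mdist_nonneg' _ _)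
  set τ := traj piM (piEstar g) p0 b0 with hτ
  have hs1 : ∀ t, (τ (t + 1)).1 = (τ t).1 + piM (τ t).1 (τ t).2 := fun t => rfl
  have hs2 : ∀ t j, (τ (t + 1)).2 j = (τ t).2 j +
    piEstar g ((τ t).1 + piM (τ t).1 (τ t).2) (piM (τ t).1 (τ t).2) (τ t).2 j := fun t j => rfl
  have hlow : ∀ t : ℕ, (D : ℤ) - t ≤ mdist (τ t).1 (g i) := by
    intro t
    induction t with
    | zero => rw [hD']; simp [hτ, traj]
    | succ t ih =>
      have := mdist_step (τ t).1 _ (g i) (hM (τ t).1 (τ t).2)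
      rw [← hs1] at this
      push_cast; omega
  have hhigh : ∀ k : ℕ, k ≤ D → mdist (τ (D - k)).1 (g i) ≤ k := by
    intro k
    induction k with
    | zero => intro _; rw [Nat.sub_zero, hend, mdist_self']; simp
    | succ k ih =>
      intro hk
      have := mdist_step (τ (D - (k + 1))).1 _ (g i) (hM (τ (D - (k + 1))).1 (τ (D - (k + 1))).2)
      rw [← hs1, show D - (k + 1) + 1 = D - k by omega] at this
      have := ih (by omega)
      push_cast; omega
  have heq : ∀ t ≤ D, mdist (τ t).1 (g i) = (D : ℤ) - t := by
    intro t ht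
    have h1 := hlow t
    have h2 := hhigh (D - t) (by omega)
    rw [show D - (D - t) = t by omega] at h2
    omega
  have hn0 : ∀ k : ℕ, k ≤ D → naN g p0 ≤ D - k → nn g (τ (D - k)).1 = 0 := by
    intro k
    induction k with
    | zero => intro _ _; rw [Nat.sub_zero, hend, nn_goal]
    | succ k ih =>
      intro hk hna
      have hc := step_cases g i _ _ _ _ (hM (τ (D - (k + 1))).1 (τ (D - (k + 1))).2)
        (hs2 (D - (k + 1)))
      have ha := hamb (D - (k + 1)) (by omega)
      have hna' : ¬ (D - (k + 1) < naN g p0) := by omega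
      rw [hs1] at ha
      have ih' := ih (by omega) (by omega)
      rw [show D - k = D - (k + 1) + 1 by omega, hs1] at ih'
      rcases hc with hc | hc | hc | hc
      · exact absurd (ha.1 hc.1) hna'
      · exact absurd (ha.1 hc.1) hna'
      · rw [← hc.2.2.1, ih']
      · rw [← hc.2.2.1, ih']
  have hphi : ∀ t ≤ D, Phi g i (τ t) = Phi g i (p0, b0) := by
    intro t
    induction t with
    | zero => intro _; rfl
    | succ t ih =>
      intro ht
      rw [← ih (by omega)]
      refine (phi_star g i _ _ _ _ (hM (τ t).1 (τ t).2) (hs2 t) ?_ ?_).symm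
      · rw [← hs1, heq _ ht, heq t (by omega)]; push_cast; ring
      · intro hna
        rw [← hs1, hamb t (by omega)] at hna
        have := hn0 (D - t) (by omega)
        rw [show D - (D - t) = t by omega] at this
        exact this (by omega)
  have hit : hitTime piM (piEstar g) p0 b0 (g i) = D := by
    unfold hitTime
    apply le_antisymm
    · exact Nat.sInf_le hend
    · have hm : (τ (sInf {t | (τ t).1 = g i})).1 = g i := Nat.sInf_mem (s := {t | (τ t).1 = g i}) ⟨D, hend⟩
      have := hlow (sInf {t | (τ t).1 = g i})
      rw [hm, mdist_self'] at this
      have h2 : D ≤ sInf {t | (τ t).1 = g i} := by omega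
      exact h2
  unfold outcome
  rw [hit, ← hphi D le_rfl, Phi_goal g i _ hend]

/-- the Mover has no incentive to deviate from a shortest path by moving
away from both goals (a step with `δd₁ = δd₂ = +1`) against `π^{E*}`. -/
theorem no_move_away_from_both_goals
    (g : Fin 2 → ℤ × ℤ) (hg : g 0 ≠ g 1) (p0 : ℤ × ℤ) (b0 : Fin 2 → ℝ)
    (hb0 : ∀ j, 0 ≤ b0 j) (i : Fin 2)
    (piM : MoverStrategy) (hM : ValidMover piM)
    (hadm : Reaches piM (piEstar g) p0 b0 (g i))
    (hdev : ∃ t, t < hitTime piM (piEstar g) p0 b0 (g i) ∧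
      mdist (traj piM (piEstar g) p0 b0 (t + 1)).1 (g 0) -
        mdist (traj piM (piEstar g) p0 b0 t).1 (g 0) = 1 ∧
      mdist (traj piM (piEstar g) p0 b0 (t + 1)).1 (g 1) -
        mdist (traj piM (piEstar g) p0 b0 t).1 (g 1) = 1)
    (piMstar : MoverStrategy) (hstar : IsMoverStar g i p0 b0 piMstar) :
    outcome g i piMstar (piEstar g) p0 b0 ≤ outcome g i piM (piEstar g) p0 b0 := by
  rw [star_value g i p0 b0 piMstar hstar]
  have hm : (traj piM (piEstar g) p0 b0 (hitTime piM (piEstar g) p0 b0 (g i))).1 = g i :=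
    Nat.sInf_mem (s := {t | (traj piM (piEstar g) p0 b0 t).1 = g i}) hadm
  unfold outcome
  rw [← Phi_goal g i _ hm]
  exact Phi_traj_mono g i piM hM p0 b0 _
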